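/- Let I and Ĩ be instruction arrays with Ĩ ≥ I, let η ≤ η̃ be configurations, let h : ℤ^d → ℕ be a starting odometer, and let V ⊆ ℤ^d be finite. If α is a sequence contained in V that is legal for η̃ under Ĩ starting from odometer h and stabilizes η̃ in V, then there exists a sequence β contained in V that is legal for η under I starting from odometer h, stabilizes η in V, and satisfies m_β(x) ≤ m_α(x) for every x ∈ ℤ^d. -/

import Mathlib

/-! Diaconis–Fulton representation for Activated Random Walks.

`NatRho` is ℕ ∪ {ρ}, ordered by 0 < ρ < 1 < 2 < ⋯, where `rho` represents one
passive particle. -/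

inductive NatRho where
  | nat : ℕ → NatRho
  | rho : NatRho
  deriving DecidableEq

namespace NatRho

/-- Embedding of `NatRho` into ℚ realizing the order 0 < ρ < 1 < 2 < ⋯. -/
def toVal : NatRho → ℚ
  | nat n => (n : ℚ)
  | rho => 1/2

instance : LE NatRho := ⟨fun a b => a.toVal ≤ b.toVal⟩
instance : LT NatRho := ⟨fun a b => a.toVal < b.toVal⟩

/-- Adding one particle: ρ + 1 = 2. -/
def succ : NatRho → NatRho
  | nat n => nat (n + 1)
  | rho => nat 2

/-- Removing one particle (only ever used when the value is ≥ 1). -/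
def pred : NatRho → NatRho
  | nat (n + 1) => nat n
  | a => a

end NatRho

/-- An instruction: `move x y` is τ_{xy}, `sleep x` is τ_{xρ}, `neutral` is ι. -/
inductive Instr (S : Type) where
  | move : S → S → Instr S
  | sleep : S → Instr S
  | neutral : Instr S
  deriving DecidableEq

/-- `ins.isAt x` : `ins` is an instruction at the site `x`. -/
def Instr.isAt {S : Type} (x : S) : Instr S → Prop
  | .move a b => a = x ∧ b ≠ x
  | .sleep a => a = x
  | .neutral => True

/-- An instruction array `I = (τ^{x,j})`. -/
abbrev InstrArray (S : Type) := S → ℕ → Instr S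

/-- Well-formed instruction array: `I x j` is an instruction at `x`. -/
def InstrArray.WF {S : Type} (I : InstrArray S) : Prop := ∀ x j, (I x j).isAt x

variable {S : Type} [DecidableEq S]

/-- Action of a single instruction on a configuration. -/
def applyInstr (ins : Instr S) (η : S → NatRho) : S → NatRho :=
  match ins with
  | .move x y => fun z => if z = x then (η x).pred else if z = y then (η y).succ else η z
  | .sleep x => fun z => if z = x ∧ η x = .nat 1 then .rho else η z
  | .neutral => η

/-- One toppling step at `x` from the state (configuration, odometer). -/
def step (I : InstrArray S) (st : (S → NatRho) × (S → ℕ)) (x : S) :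
    (S → NatRho) × (S → ℕ) :=
  (applyInstr (I x (st.2 x + 1)) st.1, Function.update st.2 x (st.2 x + 1))

/-- Running a sequence of topplings from a given state. -/
def runFrom (I : InstrArray S) (st : (S → NatRho) × (S → ℕ)) (α : List S) :
    (S → NatRho) × (S → ℕ) :=
  α.foldl (step I) st

/-- A site `x` is unstable in `η` if `η x ≥ 1`. -/
def Unstable (η : S → NatRho) (x : S) : Prop := NatRho.nat 1 ≤ η x

/-- A site `x` is stable in `η` if `η x ∈ {0, ρ}`. -/
def Stable (η : S → NatRho) (x : S) : Prop := ¬ Unstable η x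

/-- `α` is a legal sequence of topplings from the state `st`: each toppled site is
unstable at the moment of its toppling. -/
def LegalFrom (I : InstrArray S) : ((S → NatRho) × (S → ℕ)) → List S → Prop
  | _, [] => True
  | st, x :: rest => Unstable st.1 x ∧ LegalFrom I (step I st x) rest

/-- `α` is a legal sequence of topplings for the configuration `η` (odometer starting
from 0). -/
def Legal (I : InstrArray S) (η : S → NatRho) (α : List S) : Prop :=
  LegalFrom I (η, fun _ => 0) α

/-- `Φ_α η`: the result of the sequence of topplings `α` on `η`. -/
def topple (I : InstrArray S) (η : S → NatRho) (α : List S) : S → NatRho :=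
  (runFrom I (η, fun _ => 0) α).1

/-- `I' ≥ I`: each instruction either coincides, or a sleep instruction of `I` is
replaced in `I'` by the neutral instruction. -/
def InstrArray.Ge {S : Type} (I' I : InstrArray S) : Prop :=
  ∀ x j, I' x j = I x j ∨ (I x j = Instr.sleep x ∧ I' x j = Instr.neutral)

namespace NatRho

/-- The number of particles at a site, active or passive. -/
def particles : NatRho → ℕ
  | nat n => n
  | rho => 1

theorem particles_nat (n : ℕ) : (nat n).particles = n := rfl

theorem particles_rho : rho.particles = 1 := rfl

theorem nat_le_nat {m n : ℕ} : nat m ≤ nat n ↔ m ≤ n := by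
  change (m : ℚ) ≤ (n : ℚ) ↔ _
  exact Nat.cast_le

theorem rho_le_nat {n : ℕ} : rho ≤ nat n ↔ 1 ≤ n := by
  change (1 / 2 : ℚ) ≤ (n : ℚ) ↔ _
  constructor
  · intro hn
    by_contra hlt
    obtain rfl : n = 0 := by omega
    norm_num at hn
  · intro hn
    have : (1 : ℚ) ≤ n := by exact_mod_cast hn
    linarith

theorem nat_le_rho {n : ℕ} : nat n ≤ rho ↔ n = 0 := by
  change (n : ℚ) ≤ (1 / 2 : ℚ) ↔ _
  constructor
  · intro hn
    by_contra hne
    have : (1 : ℚ) ≤ n := by exact_mod_cast Nat.one_le_iff_ne_zero.mpr hne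
    linarith
  · rintro rfl
    norm_num

theorem particles_mono {a b : NatRho} (hab : a ≤ b) : a.particles ≤ b.particles := by
  cases a <;> cases b <;> simp_all [particles, nat_le_nat, rho_le_nat, nat_le_rho]

theorem one_le_iff {a : NatRho} : nat 1 ≤ a ↔ ∃ n, a = nat (n + 1) := by
  cases a with
  | nat n =>
    rw [nat_le_nat]
    exact ⟨fun hn => ⟨n - 1, by congr; omega⟩, fun ⟨k, hk⟩ => by cases hk; omega⟩
  | rho => simp [nat_le_rho]

end NatRho

/-- The number of particles leaving the site of an instruction when it is applied. -/
def Instr.departures {S : Type} : Instr S → ℕ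
  | .move _ _ => 1
  | _ => 0

/-- The number of particles arriving at `y` when an instruction is applied. -/
def Instr.arrivals (y : S) : Instr S → ℕ
  | .move _ b => if b = y then 1 else 0
  | _ => 0

theorem InstrArray.Ge.departures_eq {S : Type} {I I' : InstrArray S} (hge : I'.Ge I)
    (x : S) (j : ℕ) : (I' x j).departures = (I x j).departures := by
  rcases hge x j with e | ⟨e, esl⟩
  · rw [e]
  · rw [e, esl]; rfl

theorem InstrArray.Ge.arrivals_eq {I I' : InstrArray S} (hge : I'.Ge I)
    (x y : S) (j : ℕ) : (I' x j).arrivals y = (I x j).arrivals y := by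
  rcases hge x j with e | ⟨e, esl⟩
  · rw [e]
  · rw [e, esl]; rfl

/-- The departures from `y` caused by the first `n` instructions at `y` after odometer `h`. -/
def totalDepartures {S : Type} (I : InstrArray S) (h : S → ℕ) (y : S) (n : ℕ) : ℕ :=
  ∑ j ∈ Finset.range n, (I y (h y + j + 1)).departures

/-- The arrivals at `y` caused by the first `m x` instructions after odometer `h` at each
`x ∈ V`. -/
def totalArrivals (I : InstrArray S) (h : S → ℕ) (V : Finset S) (y : S) (m : S → ℕ) : ℕ :=
  ∑ x ∈ V, ∑ j ∈ Finset.range (m x), (I x (h x + j + 1)).arrivals y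

theorem totalArrivals_mono (I : InstrArray S) (h : S → ℕ) (V : Finset S) (y : S)
    {m m' : S → ℕ} (hm : ∀ x, m x ≤ m' x) :
    totalArrivals I h V y m ≤ totalArrivals I h V y m' :=
  Finset.sum_le_sum fun x _ =>
    Finset.sum_le_sum_of_subset (Finset.range_mono (hm x))

theorem totalArrivals_update (I : InstrArray S) (h : S → ℕ) {V : Finset S} (y : S)
    (m : S → ℕ) {x : S} (hx : x ∈ V) :
    totalArrivals I h V y (Function.update m x (m x + 1)) =
      totalArrivals I h V y m + (I x (h x + m x + 1)).arrivals y := by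
  unfold totalArrivals
  rw [← Finset.add_sum_erase V _ hx, ← Finset.add_sum_erase V _ hx]
  have hrest : ∀ z ∈ V.erase x,
      ∑ j ∈ Finset.range (Function.update m x (m x + 1) z), (I z (h z + j + 1)).arrivals y =
        ∑ j ∈ Finset.range (m z), (I z (h z + j + 1)).arrivals y := fun z hz => by
    rw [Function.update_of_ne (Finset.ne_of_mem_erase hz)]
  rw [Finset.sum_congr rfl hrest, Function.update_self, Finset.sum_range_succ]
  omega

theorem count_concat_eq_update (α : List S) (x : S) :
    (fun z => (α ++ [x]).count z) =
      Function.update (fun z => α.count z) x (α.count x + 1) := by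
  funext z
  by_cases hz : z = x
  · subst hz; simp
  · simp [hz, Ne.symm hz]

theorem runFrom_concat (I : InstrArray S) (st : (S → NatRho) × (S → ℕ)) (α : List S) (x : S) :
    runFrom I st (α ++ [x]) = step I (runFrom I st α) x := by
  simp [runFrom]

theorem legalFrom_concat (I : InstrArray S) (st : (S → NatRho) × (S → ℕ)) (α : List S) (x : S) :
    LegalFrom I st (α ++ [x]) ↔ LegalFrom I st α ∧ Unstable (runFrom I st α).1 x := by
  induction α generalizing st with
  | nil => simp [LegalFrom, runFrom]
  | cons a α ih =>
    simp only [List.cons_append, LegalFrom, ih, and_assoc]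
    rfl

theorem runFrom_snd (I : InstrArray S) (η : S → NatRho) (h : S → ℕ) (α : List S) (x : S) :
    (runFrom I (η, h) α).2 x = h x + α.count x := by
  induction α using List.reverseRecOn with
  | nil => simp [runFrom]
  | append_singleton α a ih =>
    rw [runFrom_concat]
    by_cases hx : x = a
    · subst hx; simp [step, ih]; omega
    · simp [step, hx, ih, Ne.symm hx]

/-- The site `y` was put to sleep last: after `n` topplings, the last of the instructions used
at `y` is a sleep instruction, or there is none and `y` started with a passive particle. -/
def LastSleep {S : Type} (I : InstrArray S) (η : S → NatRho) (h : S → ℕ) (y : S) (n : ℕ) : Prop :=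
  (n = 0 ∧ η y = .rho) ∨ (0 < n ∧ I y (h y + n) = .sleep y)

theorem applyInstr_apply_of_ne {ins : Instr S} {x y : S} (hins : ins.isAt x) (hxy : y ≠ x)
    (ξ : S → NatRho) :
    applyInstr ins ξ y = if ins.arrivals y = 1 then (ξ y).succ else ξ y := by
  cases ins with
  | move a b =>
    obtain ⟨rfl, -⟩ := hins
    by_cases hb : y = b
    · subst hb; simp [applyInstr, Instr.arrivals, hxy]
    · simp [applyInstr, Instr.arrivals, hxy, hb, Ne.symm hb]
  | sleep a =>
    obtain rfl : a = x := hins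
    simp [applyInstr, Instr.arrivals, hxy]
  | neutral => simp [applyInstr, Instr.arrivals]

theorem Instr.arrivals_le_one (ins : Instr S) (y : S) : ins.arrivals y ≤ 1 := by
  cases ins with
  | move a b => simp only [Instr.arrivals]; split <;> simp
  | sleep a => simp [Instr.arrivals]
  | neutral => simp [Instr.arrivals]

/-- The particle balance at `y` along a legal sequence, and the characterization of when `y`
ends with a single passive particle. -/
theorem legal_local_description {I : InstrArray S} (hI : I.WF) (η : S → NatRho) (h : S → ℕ)
    {V : Finset S} {α : List S} (hαV : ∀ x ∈ α, x ∈ V) (hα : LegalFrom I (η, h) α) (y : S) :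
    ((runFrom I (η, h) α).1 y).particles + totalDepartures I h y (α.count y) =
        (η y).particles + totalArrivals I h V y (fun x => α.count x) ∧
      ((runFrom I (η, h) α).1 y = .rho → LastSleep I η h y (α.count y)) ∧
      (LastSleep I η h y (α.count y) →
        (runFrom I (η, h) α).1 y = .rho ∨ 2 ≤ ((runFrom I (η, h) α).1 y).particles) := by
  induction α using List.reverseRecOn with
  | nil =>
    simp [runFrom, totalDepartures, totalArrivals, LastSleep]
    tauto
  | append_singleton α x ih =>
    rw [legalFrom_concat] at hα
    obtain ⟨hb, hs, hs'⟩ := ih (fun z hz => hαV z (by simp [hz])) hα.1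
    have hx : x ∈ V := hαV x (by simp)
    rw [count_concat_eq_update, totalArrivals_update I h y _ hx, runFrom_concat]
    simp only [step, runFrom_snd]
    obtain ⟨n, hn⟩ := NatRho.one_le_iff.mp hα.2
    have hat := hI x (h x + α.count x + 1)
    generalize (runFrom I (η, h) α).1 = ξ at *
    by_cases hxy : y = x
    · subst hxy
      have hc : (α ++ [y]).count y = α.count y + 1 := by simp
      rw [hc]
      simp only [totalDepartures, Finset.sum_range_succ, LastSleep, ← add_assoc] at hb hs hs' ⊢
      generalize I y (h y + α.count y + 1) = ins at *
      cases ins with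
      | move a b =>
        obtain ⟨rfl, hne⟩ := hat
        simp [applyInstr, Instr.departures, Instr.arrivals, hn, NatRho.pred,
          NatRho.particles, hne] at hb ⊢
        omega
      | sleep a =>
        obtain rfl : a = y := hat
        rcases n with _ | n <;>
        simp [applyInstr, Instr.departures, Instr.arrivals, hn, NatRho.particles] at hb ⊢ <;>
        omega
      | neutral =>
        simp [applyInstr, Instr.departures, Instr.arrivals, hn, NatRho.particles] at hb ⊢
        omega
    · have hc : (α ++ [x]).count y = α.count y := by simp [Ne.symm hxy]
      rw [hc, applyInstr_apply_of_ne hat hxy]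
      have hle := (I x (h x + α.count x + 1)).arrivals_le_one y
      generalize (I x (h x + α.count x + 1)).arrivals y = k at *
      generalize LastSleep I η h y (α.count y) = P at *
      obtain rfl | rfl : k = 0 ∨ k = 1 := by omega
      · simpa using ⟨hb, hs, hs'⟩
      · cases hξ : ξ y with
        | nat m =>
          simp [hξ, NatRho.succ, NatRho.particles] at hb hs' ⊢
          exact ⟨by omega, fun hP => by have := hs' hP; omega⟩
        | rho =>
          simp [hξ, NatRho.succ, NatRho.particles] at hb ⊢
          omega

/-- A site toppled equally often by `β` and by the stabilizing sequence `α` is stable after `β`,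
provided that `β` topples no site more often than `α`. -/
theorem stable_of_count_eq {I I' : InstrArray S} (hI : I.WF) (hI' : I'.WF) (hge : I'.Ge I)
    {η η' : S → NatRho} (hle : ∀ x, η x ≤ η' x) (h : S → ℕ) {V : Finset S} {α β : List S}
    (hαV : ∀ x ∈ α, x ∈ V) (hα : LegalFrom I' (η', h) α)
    (hβV : ∀ x ∈ β, x ∈ V) (hβ : LegalFrom I (η, h) β) (hcount : ∀ x, β.count x ≤ α.count x)
    {y : S} (hy : β.count y = α.count y) (hstab : Stable (runFrom I' (η', h) α).1 y) :
    Stable (runFrom I (η, h) β).1 y := by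
  intro hun
  obtain ⟨n, hn⟩ := NatRho.one_le_iff.mp hun
  obtain ⟨hb, -, hs⟩ := legal_local_description hI η h hβV hβ y
  obtain ⟨hb', hs', -⟩ := legal_local_description hI' η' h hαV hα y
  have hdep : totalDepartures I' h y (α.count y) = totalDepartures I h y (α.count y) :=
    Finset.sum_congr rfl fun j _ => hge.departures_eq _ _
  have harr : totalArrivals I' h V y (fun x => α.count x) =
      totalArrivals I h V y (fun x => α.count x) :=
    Finset.sum_congr rfl fun x _ => Finset.sum_congr rfl fun j _ => hge.arrivals_eq _ _ _
  have hmono := totalArrivals_mono I h V y hcount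
  have hpart := NatRho.particles_mono (hle y)
  rw [hdep, harr] at hb'
  rw [hy] at hb hs
  rw [hn] at hb hs
  simp only [NatRho.particles_nat, reduceCtorEq, false_or] at hb hs
  cases hξ : (runFrom I' (η', h) α).1 y with
  | nat m =>
    rw [hξ] at hb'
    simp only [NatRho.particles_nat] at hb'
    exact hstab (NatRho.one_le_iff.mpr ⟨m - 1, by rw [hξ]; congr; omega⟩)
  | rho =>
    rw [hξ] at hb'
    simp only [NatRho.particles_rho] at hb'
    have hawake : ¬ LastSleep I η h y (α.count y) := fun hP => by
      have := hs hP
      omega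
    rcases hs' hξ with ⟨h0, hρ⟩ | ⟨hpos, hsl⟩
    · refine hawake (Or.inl ⟨h0, ?_⟩)
      have hley := hle y
      rw [hρ] at hb' hley
      simp only [NatRho.particles_rho, h0, totalDepartures, Finset.sum_range_zero] at hb hb'
      cases hηy : η y with
      | nat k =>
        rw [hηy] at hley hb
        rw [NatRho.nat_le_rho] at hley
        simp only [NatRho.particles_nat] at hb
        omega
      | rho => rfl
    · refine hawake (Or.inr ⟨hpos, ?_⟩)
      rcases hge y (h y + α.count y) with e | ⟨e, -⟩
      · rw [← e, hsl]
      · exact e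

/-- A legal sequence that topples no site more often than `α` extends to one that moreover
stabilizes `V`, if sites toppled as often as by `α` are automatically stable. -/
theorem exists_stabilizing_of_stable_of_count_eq {I : InstrArray S} {η : S → NatRho} {h : S → ℕ}
    {V : Finset S} {α : List S}
    (hstable : ∀ β : List S, (∀ y ∈ β, y ∈ V) → LegalFrom I (η, h) β →
      (∀ x, β.count x ≤ α.count x) → ∀ y ∈ V, β.count y = α.count y →
        Stable (runFrom I (η, h) β).1 y)
    (β : List S) (hβV : ∀ y ∈ β, y ∈ V) (hβ : LegalFrom I (η, h) β)
    (hcount : ∀ x, β.count x ≤ α.count x) :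
    ∃ γ : List S, (∀ y ∈ γ, y ∈ V) ∧ LegalFrom I (η, h) γ ∧
      (∀ y ∈ V, Stable (runFrom I (η, h) γ).1 y) ∧ ∀ x, γ.count x ≤ α.count x := by
  induction hk : α.length - β.length using Nat.strong_induction_on generalizing β with
  | _ k ih =>
    by_cases hall : ∀ y ∈ V, Stable (runFrom I (η, h) β).1 y
    · exact ⟨β, hβV, hβ, hall, hcount⟩
    · push Not at hall
      obtain ⟨y, hyV, hy⟩ := hall
      have hne : β.count y ≠ α.count y := fun e => hy (hstable β hβV hβ hcount y hyV e)
      have hcount' : ∀ x, (β ++ [y]).count x ≤ α.count x := fun x => by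
        have hx := hcount x
        by_cases hxy : x = y
        · subst hxy; simp; omega
        · simpa [Ne.symm hxy] using hx
      have hlen := (List.subperm_iff_count.mpr hcount').length_le
      simp only [List.length_append, List.length_singleton] at hlen
      refine ih _ ?_ (β ++ [y]) ?_ ?_ hcount' rfl
      · simp only [List.length_append, List.length_singleton]; omega
      · intro z hz
        rcases List.mem_append.mp hz with hz | hz
        · exact hβV z hz
        · rw [List.mem_singleton.mp hz]; exact hyV
      · exact (legalFrom_concat I _ β y).mpr ⟨hβ, not_not.mp hy⟩

/-- monotonicity with enforced activation, with a general starting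
odometer `h` and an initial configuration `η̃ ≥ η`. -/
theorem arw_monotonicity_enforced_activation_general
    {d : ℕ} (hd : 1 ≤ d) (I I' : InstrArray (Fin d → ℤ)) (hI : I.WF) (hI' : I'.WF)
    (hge : I'.Ge I)
    (η η' : (Fin d → ℤ) → NatRho) (hle : ∀ x, η x ≤ η' x)
    (h : (Fin d → ℤ) → ℕ)
    (V : Finset (Fin d → ℤ)) (α : List (Fin d → ℤ))
    (hαV : ∀ y ∈ α, y ∈ V) (hα : LegalFrom I' (η', h) α)
    (hstabα : ∀ y ∈ V, Stable (runFrom I' (η', h) α).1 y) :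
    ∃ β : List (Fin d → ℤ), (∀ y ∈ β, y ∈ V) ∧ LegalFrom I (η, h) β ∧
      (∀ y ∈ V, Stable (runFrom I (η, h) β).1 y) ∧ ∀ x, β.count x ≤ α.count x := by
  exact exists_stabilizing_of_stable_of_count_eq
    (fun β hβV hβ hcount y hy e =>
      stable_of_count_eq hI hI' hge hle h hαV hα hβV hβ hcount e (hstabα y hy))
    [] (by simp) trivial (by simp)
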